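/- arXiv:2508.04844 — 7 statements merged into one kernel-verified Lean document; each statement's English description precedes it below -/
import Mathlib

section
/- Let Γ be a subgroup of SL₂(ℤ), 𝔘 ⊆ ℍ a Γ-invariant open subset, k ≥ 0 an integer, and f, g : 𝔘 → ℂ functions. Suppose F : 𝔘 × ℂ × ℂ → ℂ satisfies the harmonic-lift equation for (f,g) and is Γ-equivariant. Then f and g are modular of weight k+2 for Γ: for every γ ∈ Γ and z ∈ 𝔘 one has f(γ·z) = j_γ(z)^{k+2}·f(z) and g(γ·z) = j_γ(z)^{k+2}·g(z). -/
/- STATEMENT 0: If a Γ-equivariant vector-valued function `F` satisfies the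
harmonic-lift equation for a pair `(f, g)`, then `f` and `g` are modular of
weight `k + 2` for `Γ`. -/

open Complex ComplexConjugate

noncomputable section

abbrev SL2Z := Matrix.SpecialLinearGroup (Fin 2) ℤ

/-- The real matrix associated to an element of `SL₂(ℤ)`. -/
def toRealM (γ : SL2Z) : Matrix (Fin 2) (Fin 2) ℝ :=
  γ.val.map fun n => (n : ℝ)

/-- Automorphy factor `j_γ(z) = c·z + d` for a real matrix `γ = (a, b; c, d)`. -/
def jFac (γ : Matrix (Fin 2) (Fin 2) ℝ) (z : ℂ) : ℂ :=
  ((γ 1 0 : ℝ) : ℂ) * z + ((γ 1 1 : ℝ) : ℂ)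

/-- Möbius action `γ·z = (a·z + b)/(c·z + d)`. -/
def moeb (γ : Matrix (Fin 2) (Fin 2) ℝ) (z : ℂ) : ℂ :=
  (((γ 0 0 : ℝ) : ℂ) * z + ((γ 0 1 : ℝ) : ℂ)) / (((γ 1 0 : ℝ) : ℂ) * z + ((γ 1 1 : ℝ) : ℂ))

/-- Complex entries of an element of `SL₂(ℤ)`. -/
def entC (γ : SL2Z) (i j : Fin 2) : ℂ := ((toRealM γ i j : ℝ) : ℂ)

/-- The continuous ℝ-linear map `v ↦ a·v + b·conj v` (its coefficients record the
Wirtinger derivatives). -/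
def wirt (a b : ℂ) : ℂ →L[ℝ] ℂ :=
  a • (ContinuousLinearMap.id ℝ ℂ) + b • (Complex.conjCLE.toContinuousLinearMap)

/-- The Wirtinger coefficients of an ℝ-linear map are unique. -/
theorem wirt_inj {a b a' b' : ℂ} (h : wirt a b = wirt a' b') : a = a' ∧ b = b' := by
  have h1 : a + b = a' + b' := by
    simpa [wirt] using DFunLike.congr_fun h (1 : ℂ)
  have hI : a * I + -(b * I) = a' * I + -(b' * I) := by
    simpa [wirt] using DFunLike.congr_fun h I
  have h2 : a - b = a' - b' := mul_right_cancel₀ I_ne_zero (by linear_combination hI)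
  exact ⟨by linear_combination (h1 + h2) / 2, by linear_combination (h1 - h2) / 2⟩

/-- Precomposing with a complex scaling multiplies the Wirtinger coefficients by the scalar
and by its conjugate. -/
theorem wirt_comp_wirt_zero (a b m : ℂ) :
    (wirt a b).comp (wirt m 0) = wirt (a * m) (b * conj m) := by
  ext
  simp [wirt]
  ring

theorem HasDerivAt.hasFDerivAt_wirt {φ : ℂ → ℂ} {m z : ℂ} (h : HasDerivAt φ m z) :
    HasFDerivAt φ (wirt m 0) z := by
  refine (h.hasFDerivAt.restrictScalars ℝ).congr_fderiv ?_
  ext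
  simp [wirt, mul_comm]

theorem toRealM_det (γ : SL2Z) :
    ((toRealM γ 0 0 : ℝ) : ℂ) * ((toRealM γ 1 1 : ℝ) : ℂ) -
      ((toRealM γ 0 1 : ℝ) : ℂ) * ((toRealM γ 1 0 : ℝ) : ℂ) = 1 := by
  have h := γ.property
  rw [Matrix.det_fin_two] at h
  simp only [toRealM, Matrix.map_apply]
  exact_mod_cast h

theorem jFac_toRealM_ne_zero (γ : SL2Z) {z : ℂ} (hz : 0 < z.im) : jFac (toRealM γ) z ≠ 0 := by
  intro h
  have hdet := toRealM_det γ
  have hc : toRealM γ 1 0 = 0 := by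
    have him := congrArg Complex.im h
    simpa [jFac, hz.ne'] using him
  have hd : toRealM γ 1 1 = 0 := by
    have hre := congrArg Complex.re h
    simpa [jFac, hc] using hre
  simp [hc, hd] at hdet

theorem hasDerivAt_moeb (γ : SL2Z) {z : ℂ} (hj : jFac (toRealM γ) z ≠ 0) :
    HasDerivAt (moeb (toRealM γ)) (1 / jFac (toRealM γ) z ^ 2) z := by
  have hdet := toRealM_det γ
  have hnum := ((hasDerivAt_id z).const_mul ((toRealM γ 0 0 : ℝ) : ℂ)).add_const
    ((toRealM γ 0 1 : ℝ) : ℂ)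
  have hden := ((hasDerivAt_id z).const_mul ((toRealM γ 1 0 : ℝ) : ℂ)).add_const
    ((toRealM γ 1 1 : ℝ) : ℂ)
  refine (hnum.div hden hj).congr_deriv ?_
  rw [jFac, id]
  congr 1
  linear_combination hdet

theorem entC_sub_moeb_mul (γ : SL2Z) {z : ℂ} (hj : jFac (toRealM γ) z ≠ 0) :
    entC γ 0 0 - moeb (toRealM γ) z * entC γ 1 0 = 1 / jFac (toRealM γ) z := by
  have hdet := toRealM_det γ
  have hmoeb : moeb (toRealM γ) z * jFac (toRealM γ) z =
      entC γ 0 0 * z + entC γ 0 1 := div_mul_cancel₀ _ hj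
  rw [eq_div_iff hj, sub_mul, mul_right_comm, hmoeb]
  simp only [jFac, entC]
  linear_combination hdet

theorem statement_0
    (Γ : Subgroup SL2Z) (𝔘 : Set ℂ) (hopen : IsOpen 𝔘)
    (hUH : 𝔘 ⊆ {z : ℂ | 0 < z.im})
    (hinv : ∀ γ ∈ Γ, ∀ z ∈ 𝔘, moeb (toRealM γ) z ∈ 𝔘)
    (k : ℕ) (f g : ℂ → ℂ) (F : ℂ → ℂ → ℂ → ℂ)
    (hHL : ∀ x y : ℂ, ∀ z ∈ 𝔘,
      HasFDerivAt (fun ζ : ℂ => F ζ x y)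
        (wirt (f z * (x - z * y) ^ k) (-(conj (g z)) * (x - conj z * y) ^ k)) z)
    (hequiv : ∀ γ ∈ Γ, ∀ z ∈ 𝔘, ∀ x y : ℂ,
      F (moeb (toRealM γ) z) (entC γ 0 0 * x + entC γ 0 1 * y)
        (entC γ 1 0 * x + entC γ 1 1 * y) = F z x y) :
    ∀ γ ∈ Γ, ∀ z ∈ 𝔘,
      f (moeb (toRealM γ) z) = jFac (toRealM γ) z ^ (k + 2) * f z ∧
      g (moeb (toRealM γ) z) = jFac (toRealM γ) z ^ (k + 2) * g z := by
  intro γ hγ z hz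
  have hj : jFac (toRealM γ) z ≠ 0 := jFac_toRealM_ne_zero γ (hUH hz)
  have hcomp := (hHL (entC γ 0 0) (entC γ 1 0) _ (hinv γ hγ z hz)).comp z
    (hasDerivAt_moeb γ hj).hasFDerivAt_wirt
  have hF : HasFDerivAt (fun ζ : ℂ => F ζ 1 0) _ z :=
    hcomp.congr_of_eventuallyEq <| by
      filter_upwards [hopen.mem_nhds hz] with ζ hζ
      simpa using (hequiv γ hγ ζ hζ 1 0).symm
  have heq := hF.unique (hHL 1 0 z hz)
  have hconj : entC γ 0 0 - conj (moeb (toRealM γ) z) * entC γ 1 0 =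
      conj (1 / jFac (toRealM γ) z) := by
    rw [← entC_sub_moeb_mul γ hj]
    simp [entC]
  rw [wirt_comp_wirt_zero, entC_sub_moeb_mul γ hj, hconj] at heq
  obtain ⟨hf, hg⟩ := wirt_inj heq
  have hg' : g (moeb (toRealM γ) z) * (1 / jFac (toRealM γ) z) ^ k *
      (1 / jFac (toRealM γ) z ^ 2) = g z := by
    apply (starRingEnd ℂ).injective
    simp only [map_mul, map_pow]
    simp only [mul_zero, sub_zero, one_pow, mul_one] at hg
    linear_combination -hg
  simp only [mul_zero, sub_zero, one_pow, mul_one] at hf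
  constructor
  · rw [← hf, one_div_pow]
    field_simp
    ring
  · rw [← hg', one_div_pow]
    field_simp
    ring
end
end

section
/- Let Γ be a finite-index subgroup of SL₂(ℤ), k ≥ 1 an integer, 𝔘 ⊆ ℍ a connected Γ-invariant open subset, and f, g : 𝔘 → ℂ. For j = 1, 2 let c⁽ʲ⁾₀, …, c⁽ʲ⁾_k : 𝔘 → ℂ be functions such that F_j(z,x,y) := Σ_{i=0}^{k} c⁽ʲ⁾_i(z)·x^{k−i}·y^{i} satisfies the harmonic-lift equation for (f,g) and is Γ-equivariant. Then F₁ = F₂, i.e. c⁽¹⁾_i = c⁽²⁾_i on 𝔘 for every 0 ≤ i ≤ k. -/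
/- STATEMENT 1: Uniqueness of the harmonic lift of a pair `(f, g)` for a
finite-index subgroup `Γ ≤ SL₂(ℤ)` and `k ≥ 1`. -/

open Complex ComplexConjugate

noncomputable section

open Polynomial in
/-- A polynomial function with a nonzero period has vanishing nonconstant coefficients. -/
theorem coeff_eq_zero_of_periodic (k : ℕ) (d : ℕ → ℂ) (n : ℂ) (hn : n ≠ 0)
    (h : ∀ y : ℂ, ∑ i ∈ Finset.range (k + 1), d i * (y + n) ^ i =
      ∑ i ∈ Finset.range (k + 1), d i * y ^ i) {i : ℕ} (hik : i ≤ k) (hi : i ≠ 0) :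
    d i = 0 := by
  set q : ℂ[X] := ∑ i ∈ Finset.range (k + 1), C (d i) * X ^ i with hq
  have hev (y : ℂ) : q.eval y = ∑ i ∈ Finset.range (k + 1), d i * y ^ i := by
    simp [hq, eval_finsetSum]
  have hmul (m : ℕ) : q.eval (m * n) = q.eval 0 := by
    induction m with
    | zero => simp
    | succ m ih =>
      rw [← ih, hev, hev, ← h (m * n), Nat.cast_succ, add_one_mul]
  have hconst : q = C (q.eval 0) := by
    refine eq_of_infinite_eval_eq _ _ (Set.Infinite.mono ?_
      (Set.infinite_range_of_injective (f := fun m : ℕ => (m : ℂ) * n) ?_))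
    · rintro _ ⟨m, rfl⟩
      simpa using hmul m
    · intro a b hab
      exact Nat.cast_injective (mul_right_cancel₀ hn hab)
  have hcoeff : q.coeff i = d i := by
    simp [hq, coeff_C_mul, coeff_X_pow, hik]
  rw [← hcoeff, hconst, coeff_C_of_ne_zero hi]

theorem exists_upper_unipotent_mem (Γ : Subgroup SL2Z) (hΓ : Γ.FiniteIndex) :
    ∃ n : ℕ, n ≠ 0 ∧ ∃ γ ∈ Γ, γ.val = !![1, (n : ℤ); 0, 1] := by
  obtain ⟨n, hn, -, hmem⟩ := Γ.exists_pow_mem_of_index_ne_zero hΓ.index_ne_zero ModularGroup.T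
  refine ⟨n, hn.ne', _, hmem, ?_⟩
  simpa using ModularGroup.coe_T_zpow n

theorem exists_lower_unipotent_mem (Γ : Subgroup SL2Z) (hΓ : Γ.FiniteIndex) :
    ∃ n : ℕ, n ≠ 0 ∧ ∃ γ ∈ Γ, γ.val = !![1, 0; (n : ℤ), 1] := by
  obtain ⟨n, hn, -, hmem⟩ :=
    Γ.exists_pow_mem_of_index_ne_zero hΓ.index_ne_zero ModularGroup.T.transpose
  refine ⟨n, hn.ne', _, hmem, ?_⟩
  have hT := ModularGroup.coe_T_zpow n
  rw [zpow_natCast] at hT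
  have := congrArg Matrix.transpose hT
  rw [Matrix.SpecialLinearGroup.coe_pow, Matrix.transpose_pow] at this
  rw [Matrix.SpecialLinearGroup.coe_pow, Matrix.SpecialLinearGroup.coe_transpose, this]
  ext i j
  fin_cases i <;> fin_cases j <;> rfl

/-- A binary form of positive degree invariant under a finite-index subgroup of `SL₂(ℤ)`
vanishes. -/
theorem invariant_form_eq_zero (Γ : Subgroup SL2Z) (hΓ : Γ.FiniteIndex) (k : ℕ) (hk : 1 ≤ k)
    (d : ℕ → ℂ)
    (h : ∀ γ ∈ Γ, ∀ x y : ℂ,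
      ∑ i ∈ Finset.range (k + 1),
          d i * (entC γ 0 0 * x + entC γ 0 1 * y) ^ (k - i) *
            (entC γ 1 0 * x + entC γ 1 1 * y) ^ i =
        ∑ i ∈ Finset.range (k + 1), d i * x ^ (k - i) * y ^ i) :
    ∀ i ≤ k, d i = 0 := by
  intro i hi
  rcases eq_or_ne i 0 with rfl | hi0
  · obtain ⟨n, hn, γ, hγ, hval⟩ := exists_upper_unipotent_mem Γ hΓ
    have hreflect (y : ℂ) : ∑ i ∈ Finset.range (k + 1), d (k - i) * y ^ i =
        ∑ i ∈ Finset.range (k + 1), d i * y ^ (k - i) := by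
      rw [← Finset.sum_range_reflect]
      refine Finset.sum_congr rfl fun i hi => ?_
      have : i ≤ k := Nat.lt_succ_iff.mp (Finset.mem_range.mp hi)
      simp [Nat.sub_sub_self this]
    have := coeff_eq_zero_of_periodic k (fun i => d (k - i)) n (Nat.cast_ne_zero.mpr hn)
      (fun y => by
        rw [hreflect, hreflect]
        simpa [entC, toRealM, hval] using h γ hγ y 1) le_rfl (Nat.one_le_iff_ne_zero.mp hk)
    simpa using this
  · obtain ⟨n, hn, γ, hγ, hval⟩ := exists_lower_unipotent_mem Γ hΓ
    exact coeff_eq_zero_of_periodic k d n (Nat.cast_ne_zero.mpr hn)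
      (fun y => by simpa [entC, toRealM, hval, add_comm] using h γ hγ 1 y) hi hi0

theorem statement_1
    (Γ : Subgroup SL2Z) (hΓ : Γ.FiniteIndex) (k : ℕ) (hk : 1 ≤ k)
    (𝔘 : Set ℂ) (hopen : IsOpen 𝔘) (hconn : IsConnected 𝔘)
    (hUH : 𝔘 ⊆ {z : ℂ | 0 < z.im})
    (hinv : ∀ γ ∈ Γ, ∀ z ∈ 𝔘, moeb (toRealM γ) z ∈ 𝔘)
    (f g : ℂ → ℂ) (c₁ c₂ : ℕ → ℂ → ℂ)
    (hHL₁ : ∀ x y : ℂ, ∀ z ∈ 𝔘,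
      HasFDerivAt
        (fun ζ : ℂ => ∑ i ∈ Finset.range (k + 1), c₁ i ζ * x ^ (k - i) * y ^ i)
        (wirt (f z * (x - z * y) ^ k) (-(conj (g z)) * (x - conj z * y) ^ k)) z)
    (hHL₂ : ∀ x y : ℂ, ∀ z ∈ 𝔘,
      HasFDerivAt
        (fun ζ : ℂ => ∑ i ∈ Finset.range (k + 1), c₂ i ζ * x ^ (k - i) * y ^ i)
        (wirt (f z * (x - z * y) ^ k) (-(conj (g z)) * (x - conj z * y) ^ k)) z)
    (heqv₁ : ∀ γ ∈ Γ, ∀ z ∈ 𝔘, ∀ x y : ℂ,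
      ∑ i ∈ Finset.range (k + 1),
          c₁ i (moeb (toRealM γ) z) * (entC γ 0 0 * x + entC γ 0 1 * y) ^ (k - i) *
            (entC γ 1 0 * x + entC γ 1 1 * y) ^ i =
        ∑ i ∈ Finset.range (k + 1), c₁ i z * x ^ (k - i) * y ^ i)
    (heqv₂ : ∀ γ ∈ Γ, ∀ z ∈ 𝔘, ∀ x y : ℂ,
      ∑ i ∈ Finset.range (k + 1),
          c₂ i (moeb (toRealM γ) z) * (entC γ 0 0 * x + entC γ 0 1 * y) ^ (k - i) *
            (entC γ 1 0 * x + entC γ 1 1 * y) ^ i =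
        ∑ i ∈ Finset.range (k + 1), c₂ i z * x ^ (k - i) * y ^ i) :
    ∀ i ≤ k, ∀ z ∈ 𝔘, c₁ i z = c₂ i z := by
  intro i hi z hz
  have hconst (x y : ℂ) {z w : ℂ} (hz : z ∈ 𝔘) (hw : w ∈ 𝔘) :
      ∑ i ∈ Finset.range (k + 1), (c₁ i z - c₂ i z) * x ^ (k - i) * y ^ i =
        ∑ i ∈ Finset.range (k + 1), (c₁ i w - c₂ i w) * x ^ (k - i) * y ^ i := by
    have hderiv : ∀ ζ ∈ 𝔘, HasFDerivAt (fun ζ : ℂ =>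
        ∑ i ∈ Finset.range (k + 1), (c₁ i ζ - c₂ i ζ) * x ^ (k - i) * y ^ i)
        (0 : ℂ →L[ℝ] ℂ) ζ := fun ζ hζ => by
      simpa only [sub_self, ← Finset.sum_sub_distrib, ← sub_mul] using
        (hHL₁ x y ζ hζ).fun_sub (hHL₂ x y ζ hζ)
    exact hopen.is_const_of_fderiv_eq_zero (𝕜 := ℝ) hconn.isPreconnected
      (fun ζ hζ => (hderiv ζ hζ).differentiableAt.differentiableWithinAt)
      (fun ζ hζ => (hderiv ζ hζ).fderiv) hz hw
  refine sub_eq_zero.mp (invariant_form_eq_zero Γ hΓ k hk (fun i => c₁ i z - c₂ i z) ?_ i hi)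
  intro γ hγ x y
  rw [hconst _ _ hz (hinv γ hγ z hz)]
  simpa only [sub_mul, Finset.sum_sub_distrib] using
    congrArg₂ (· - ·) (heqv₁ γ hγ z hz x y) (heqv₂ γ hγ z hz x y)
end
end

section
/- Let Γ be a finite-index subgroup of SL₂(ℤ), let p, q be integers with p + q > 0, and let z, w ∈ ℂ∖ℝ be such that γ·z ∉ {w, conj w} for every γ ∈ Γ. Then the family γ ↦ j_γ(z)^{−(p+q+2)}·ψ^{p,q}(γ·z, w), indexed by γ ∈ Γ, is summable in ℂ. -/
/- STATEMENT 4: Summability of the family defining the meromorphic Poincaré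
series `Ψ_Γ^{p,q}(z, w)`. -/

open Complex ComplexConjugate

noncomputable section

/-- `ψ^{p,q}(z,w) = (w − conj w)/((z − w)^(p+1)·(z − conj w)^(q+1))`. -/
def psiPQ (p q : ℤ) (z w : ℂ) : ℂ :=
  (w - conj w) / ((z - w) ^ (p + 1) * (z - conj w) ^ (q + 1))

open Filter Asymptotics

/-- The largest absolute value of an entry. -/
def entryMax (γ : SL2Z) : ℝ := max ‖γ.val 0‖ ‖γ.val 1‖

/-- The quantity `j_γ(z)·(γ·z - w)`, as a form that is linear in the entries of `γ`. -/
def entryForm (z w : ℂ) (γ : SL2Z) : ℂ :=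
  (γ.val 0 0 * z + γ.val 0 1) - w * (γ.val 1 0 * z + γ.val 1 1)

lemma SL2Z.det_eq (γ : SL2Z) :
    γ.val 0 0 * γ.val 1 1 - γ.val 0 1 * γ.val 1 0 = 1 := by
  rw [← Matrix.det_fin_two, γ.2]

lemma norm_intVec_eq (x : Fin 2 → ℤ) : ‖x‖ = ((max |x 0| |x 1| : ℤ) : ℝ) := by
  apply le_antisymm
  · rw [pi_norm_le_iff_of_nonneg (by positivity)]
    intro i
    fin_cases i <;> simp [Int.norm_eq_abs]
  · have h0 := norm_le_pi_norm x 0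
    have h1 := norm_le_pi_norm x 1
    simp only [Int.norm_eq_abs] at h0 h1
    push_cast
    exact max_le h0 h1

/-- A vector completing `(c, d)` to determinant `1`, and no longer than `(c, d)`, is determined by
its residue mod `3`. -/
lemma completion_unique {a b a' b' c d : ℤ} (h : a * d - b * c = 1) (h' : a' * d - b' * c = 1)
    (hle : max |a| |b| ≤ max |c| |d|) (hle' : max |a'| |b'| ≤ max |c| |d|)
    (ha : (a : ZMod 3) = a') (hb : (b : ZMod 3) = b') : a = a' ∧ b = b' := by
  obtain ⟨n, hn⟩ : ∃ n, n = a * b' - b * a' := ⟨_, rfl⟩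
  have hna : a' - a = n * c := by rw [hn]; linear_combination a * h' - a' * h
  have hnb : b' - b = n * d := by rw [hn]; linear_combination b * h' - b' * h
  have h3 : (3 : ℤ) ∣ n := by
    refine (ZMod.intCast_zmod_eq_zero_iff_dvd n 3).mp ?_
    rw [hn]
    push_cast
    rw [ha, hb]
    ring
  have hpos : 0 < max |c| |d| := by
    by_contra! hc
    have hc0 : c = 0 := abs_nonpos_iff.mp ((le_max_left _ _).trans hc)
    have hd0 : d = 0 := abs_nonpos_iff.mp ((le_max_right _ _).trans hc)
    simp [hc0, hd0] at h
  have hn0 : n = 0 := by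
    have key : |n| * max |c| |d| ≤ 2 * max |c| |d| := by
      rw [mul_max_of_nonneg _ _ (abs_nonneg n), ← abs_mul, ← abs_mul, ← hna, ← hnb]
      have h1 := abs_sub a' a
      have h2 := abs_sub b' b
      simp only [max_le_iff] at hle hle'
      apply max_le <;> linarith [hle.1, hle.2, hle'.1, hle'.2]
    have h2 : |n| ≤ 2 := le_of_mul_le_mul_right key hpos
    rw [abs_le] at h2
    omega
  rw [hn0] at hna hnb
  constructor <;> linarith

/-- One row of `γ`, together with the residues mod `3` of the other row. -/
def rowResidue (i j : Fin 2) (γ : SL2Z) : (Fin 2 → ℤ) × (ZMod 3 × ZMod 3) :=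
  (γ.val i, (γ.val j 0 : ZMod 3), (γ.val j 1 : ZMod 3))

lemma injOn_rowResidue {i j : Fin 2} (hij : i ≠ j) :
    Set.InjOn (rowResidue i j) {γ | ‖γ.val j‖ ≤ ‖γ.val i‖} := by
  intro γ hγ δ hδ heq
  simp only [rowResidue, Prod.mk.injEq, Set.mem_ofPred_eq] at heq hγ hδ
  obtain ⟨hi, h0, h1⟩ := heq
  rw [norm_intVec_eq, norm_intVec_eq, Int.cast_le] at hγ hδ
  have hdγ := SL2Z.det_eq γ
  have hdδ := SL2Z.det_eq δ
  rw [← hi] at hδ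
  obtain ⟨rfl, rfl⟩ | ⟨rfl, rfl⟩ : (i = 1 ∧ j = 0) ∨ (i = 0 ∧ j = 1) := by omega
  · rw [← hi] at hdδ
    obtain ⟨ha, hb⟩ := completion_unique hdγ hdδ hγ hδ h0 h1
    apply Subtype.ext
    rw [Matrix.eta_fin_two γ.val, Matrix.eta_fin_two δ.val, ← hi, ha, hb]
  · rw [← hi] at hdδ
    rw [max_comm, max_comm |γ.val 0 0|] at hγ hδ
    obtain ⟨hb, ha⟩ := completion_unique (by linarith) (by linarith) hγ hδ h1 h0
    apply Subtype.ext
    rw [Matrix.eta_fin_two γ.val, Matrix.eta_fin_two δ.val, ← hi, ha, hb]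

lemma summable_norm_fst_rpow (κ : Type*) [Finite κ] {k : ℝ} (hk : 2 < k) :
    Summable fun x : (Fin 2 → ℤ) × κ => ‖x.1‖ ^ (-k) := by
  have hone : Summable fun _ : κ => (1 : ℝ) := Summable.of_finite
  simpa only [mul_one] using (EisensteinSeries.summable_one_div_norm_rpow hk).mul_of_nonneg hone
    (fun x => Real.rpow_nonneg (norm_nonneg x) _) (fun _ => zero_le_one)

lemma summable_norm_row_rpow {i j : Fin 2} (hij : i ≠ j) {k : ℝ} (hk : 2 < k) :
    Summable fun γ : {γ : SL2Z | ‖γ.val j‖ ≤ ‖γ.val i‖} => ‖γ.1.val i‖ ^ (-k) := by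
  have h := (summable_norm_fst_rpow (ZMod 3 × ZMod 3) hk).comp_injective
    (injOn_rowResidue hij).injective
  exact h

lemma summable_entryMax_rpow {k : ℝ} (hk : 2 < k) :
    Summable fun γ : SL2Z => entryMax γ ^ (-k) := by
  rw [← summable_subtype_and_compl (s := {γ : SL2Z | ‖γ.val 0‖ ≤ ‖γ.val 1‖})]
  constructor
  · refine (summable_norm_row_rpow (i := 1) (j := 0) (by decide) hk).congr fun γ => ?_
    rw [entryMax, max_eq_right γ.2]
  · refine ((summable_norm_row_rpow (i := 0) (j := 1) (by decide) hk).comp_injective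
      (i := fun γ : ({γ : SL2Z | ‖γ.val 0‖ ≤ ‖γ.val 1‖}ᶜ : Set SL2Z) =>
        ⟨γ.1, (lt_of_not_ge (show ¬‖γ.1.val 0‖ ≤ ‖γ.1.val 1‖ from γ.2)).le⟩) ?_).congr fun γ => ?_
    · intro γ δ h
      simpa [Subtype.ext_iff] using h
    · have hγ : ¬‖γ.1.val 0‖ ≤ ‖γ.1.val 1‖ := γ.2
      rw [entryMax, max_eq_left (lt_of_not_ge hγ).le]
      rfl

lemma entryMax_pos (γ : SL2Z) : 0 < entryMax γ := by
  rw [entryMax, lt_max_iff, norm_pos_iff]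
  left
  intro h
  simpa [h] using SL2Z.det_eq γ

lemma tendsto_entryMax : Tendsto entryMax cofinite atTop := by
  have h0 := (summable_entryMax_rpow (k := 3) (by norm_num)).tendsto_cofinite_zero
  have h1 : Tendsto (fun γ => entryMax γ ^ (-3 : ℝ)) cofinite (nhdsWithin 0 (Set.Ioi 0)) :=
    tendsto_nhdsWithin_iff.mpr ⟨h0, .of_forall fun γ => Real.rpow_pos_of_pos (entryMax_pos γ) _⟩
  have h2 := (tendsto_rpow_atTop (y := 1 / 3) (by norm_num)).comp
    (tendsto_inv_nhdsGT_zero.comp h1)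
  refine h2.congr fun γ => ?_
  have := (entryMax_pos γ).le
  simp only [Function.comp_apply]
  rw [← Real.rpow_neg this, ← Real.rpow_mul this]
  norm_num

lemma norm_intVec_le_mul_norm {z : ℂ} (hz : z.im ≠ 0) (x : Fin 2 → ℤ) :
    ‖x‖ ≤ (1 + (1 + ‖z‖) / |z.im|) * ‖(x 0 * z + x 1 : ℂ)‖ := by
  have hy : 0 < |z.im| := abs_pos.mpr hz
  set N := ‖(x 0 * z + x 1 : ℂ)‖ with hN
  have h0 : |(x 0 : ℝ)| ≤ N / |z.im| := by
    rw [le_div_iff₀ hy, ← abs_mul]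
    simpa using Complex.abs_im_le_norm (x 0 * z + x 1 : ℂ)
  have h1 : |(x 1 : ℝ)| ≤ N + |(x 0 : ℝ)| * ‖z‖ := by
    have := norm_sub_le (x 0 * z + x 1 : ℂ) (x 0 * z)
    rw [add_sub_cancel_left, norm_mul] at this
    simpa using this
  have hNn : 0 ≤ N := norm_nonneg _
  have h2 : |(x 0 : ℝ)| * ‖z‖ ≤ N / |z.im| * ‖z‖ := by gcongr
  have h3 : 0 ≤ N / |z.im| * ‖z‖ := by positivity
  have h4 : 0 ≤ N / |z.im| := by positivity
  have h5 : (1 + (1 + ‖z‖) / |z.im|) * N = N + N / |z.im| + N / |z.im| * ‖z‖ := by ring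
  rw [norm_intVec_eq, h5]
  push_cast
  apply max_le <;> linarith

lemma norm_linear_le (z : ℂ) (x : Fin 2 → ℤ) :
    ‖(x 0 * z + x 1 : ℂ)‖ ≤ (‖z‖ + 1) * ‖x‖ := by
  have h0 := norm_le_pi_norm x 0
  have h1 := norm_le_pi_norm x 1
  calc ‖(x 0 * z + x 1 : ℂ)‖ ≤ ‖x 0‖ * ‖z‖ + ‖x 1‖ := by
        simpa [Int.norm_eq_abs] using norm_add_le (x 0 * z : ℂ) (x 1)
    _ ≤ ‖x‖ * ‖z‖ + ‖x‖ := by gcongr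
    _ = _ := by ring

lemma norm_denom_le {z w : ℂ} (hw : w.im ≠ 0) (γ : SL2Z) :
    ‖(γ.val 1 0 * z + γ.val 1 1 : ℂ)‖ ≤ 1 + (|z.im| + ‖entryForm z w γ‖) / |w.im| := by
  have hv : 0 < |w.im| := abs_pos.mpr hw
  set J : ℂ := γ.val 1 0 * z + γ.val 1 1 with hJ
  have hdet : (γ.val 0 0 * γ.val 1 1 - γ.val 0 1 * γ.val 1 0 : ℝ) = 1 := by
    exact_mod_cast SL2Z.det_eq γ
  have him : (entryForm z w γ * conj J).im = z.im - w.im * ‖J‖ ^ 2 := by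
    rw [← Complex.normSq_eq_norm_sq]
    simp only [entryForm, hJ, normSq_apply, map_add, map_mul, map_intCast, mul_im, mul_re, sub_re,
      sub_im, add_re, add_im, conj_re, conj_im, intCast_re, intCast_im]
    linear_combination z.im * hdet
  have hle : |w.im| * ‖J‖ ^ 2 ≤ |z.im| + ‖entryForm z w γ‖ * ‖J‖ := by
    have h1 := Complex.abs_im_le_norm (entryForm z w γ * conj J)
    rw [him, norm_mul, RCLike.norm_conj] at h1
    have h2 := abs_sub z.im (z.im - w.im * ‖J‖ ^ 2)
    rw [sub_sub_cancel, abs_mul, abs_of_nonneg (sq_nonneg ‖J‖)] at h2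
    linarith
  rcases le_total ‖J‖ 1 with h | h
  · have : 0 ≤ (|z.im| + ‖entryForm z w γ‖) / |w.im| := by positivity
    linarith
  · have : ‖J‖ ≤ (|z.im| + ‖entryForm z w γ‖) / |w.im| := by
      rw [le_div_iff₀ hv]
      have hz := abs_nonneg z.im
      nlinarith
    linarith

lemma isTheta_entryForm {z w : ℂ} (hz : z.im ≠ 0) (hw : w.im ≠ 0) :
    entryForm z w =Θ[cofinite] entryMax := by
  constructor
  · refine IsBigO.of_bound ((‖z‖ + 1) + ‖w‖ * (‖z‖ + 1)) (.of_forall fun γ => ?_)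
    rw [Real.norm_of_nonneg (entryMax_pos γ).le]
    calc ‖entryForm z w γ‖
        ≤ (‖z‖ + 1) * ‖γ.val 0‖ + ‖w‖ * ((‖z‖ + 1) * ‖γ.val 1‖) := by
          refine (norm_sub_le _ _).trans ?_
          rw [norm_mul]
          gcongr <;> exact norm_linear_le _ _
      _ ≤ (‖z‖ + 1) * entryMax γ + ‖w‖ * ((‖z‖ + 1) * entryMax γ) := by
          gcongr
          exacts [le_max_left _ _, le_max_right _ _]
      _ = _ := by ring
  · set C := 1 + (1 + ‖z‖) / |z.im|
    have hC : 0 ≤ C := by positivity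
    set A := C * ((1 + ‖w‖) * (1 + |z.im| / |w.im|))
    set B := C * (1 + (1 + ‖w‖) / |w.im|)
    have key (γ : SL2Z) : entryMax γ ≤ A + B * ‖entryForm z w γ‖ := by
      set J : ℂ := γ.val 1 0 * z + γ.val 1 1 with hJ
      have hnum : ‖(γ.val 0 0 * z + γ.val 0 1 : ℂ)‖ ≤ ‖entryForm z w γ‖ + ‖w‖ * ‖J‖ := by
        rw [← norm_mul]
        simpa [entryForm, ← hJ] using norm_add_le (entryForm z w γ) (w * J)
      have hmax : entryMax γ ≤ C * (‖entryForm z w γ‖ + (1 + ‖w‖) * ‖J‖) := by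
        apply max_le
        · refine (norm_intVec_le_mul_norm hz _).trans ?_
          gcongr
          nlinarith [norm_nonneg J]
        · refine (norm_intVec_le_mul_norm hz _).trans ?_
          gcongr
          nlinarith [norm_nonneg J, norm_nonneg w, norm_nonneg (entryForm z w γ),
            mul_nonneg (norm_nonneg w) (norm_nonneg J)]
      calc entryMax γ ≤ C * (‖entryForm z w γ‖ + (1 + ‖w‖) *
            (1 + (|z.im| + ‖entryForm z w γ‖) / |w.im|)) := by
            refine hmax.trans ?_
            gcongr
            exact norm_denom_le hw γ
        _ = _ := by ring
    refine IsBigO.of_bound (2 * B) ?_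
    filter_upwards [tendsto_entryMax.eventually_ge_atTop (2 * A)] with γ hγ
    rw [Real.norm_of_nonneg (entryMax_pos γ).le]
    linarith [key γ]

lemma linear_ne_zero {z : ℂ} (hz : z.im ≠ 0) {x : Fin 2 → ℤ} (hx : x ≠ 0) :
    (x 0 * z + x 1 : ℂ) ≠ 0 := by
  intro h
  have := norm_intVec_le_mul_norm hz x
  rw [h, norm_zero, mul_zero] at this
  exact hx (norm_le_zero_iff.mp this)

lemma jFac_zpow_mul_psiPQ (p q : ℤ) {z : ℂ} (w : ℂ) (hz : z.im ≠ 0) (γ : SL2Z) :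
    jFac (toRealM γ) z ^ (-(p + q + 2)) * psiPQ p q (moeb (toRealM γ) z) w =
      (w - conj w) * (entryForm z w γ ^ (-(p + 1)) * entryForm z (conj w) γ ^ (-(q + 1))) := by
  have hrow : γ.val 1 ≠ 0 := fun h => by simpa [h] using SL2Z.det_eq γ
  have hJ := linear_ne_zero hz hrow
  have hsub (u : ℂ) : moeb (toRealM γ) z - u =
      entryForm z u γ / (γ.val 1 0 * z + γ.val 1 1 : ℂ) := by
    simp only [moeb, toRealM, Matrix.map_apply, ofReal_intCast, entryForm]
    rw [sub_div, mul_div_assoc, div_self hJ, mul_one]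
  simp only [psiPQ, hsub, div_zpow]
  simp only [jFac, toRealM, Matrix.map_apply, ofReal_intCast]
  have hexp : -(p + q + 2) = -(p + 1) + -(q + 1) := by ring
  rw [hexp, zpow_add₀ hJ, zpow_neg, zpow_neg, zpow_neg, zpow_neg]
  have h1 := zpow_ne_zero (p + 1) hJ
  have h2 := zpow_ne_zero (q + 1) hJ
  simp only [div_eq_mul_inv, mul_inv, inv_inv]
  field_simp

lemma summable_jFac_zpow_mul_psiPQ {p q : ℤ} (hpq : 0 < p + q) {z w : ℂ} (hz : z.im ≠ 0)
    (hw : w.im ≠ 0) :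
    Summable fun γ : SL2Z =>
      jFac (toRealM γ) z ^ (-(p + q + 2)) * psiPQ p q (moeb (toRealM γ) z) w := by
  have hk : (2 : ℝ) < ((p + q + 2 : ℤ) : ℝ) := by exact_mod_cast (by omega : 2 < p + q + 2)
  have hw' : (conj w).im ≠ 0 := by simpa using hw
  have hO := (((isTheta_entryForm hz hw).zpow (-(p + 1))).mul
    ((isTheta_entryForm hz hw').zpow (-(q + 1)))).1.const_mul_left (w - conj w)
  refine summable_of_isBigO (summable_entryMax_rpow hk) ?_
  refine hO.congr (fun γ => (jFac_zpow_mul_psiPQ p q w hz γ).symm) fun γ => ?_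
  rw [← zpow_add₀ (entryMax_pos γ).ne', ← Int.cast_neg, Real.rpow_intCast]
  congr 1
  ring

theorem statement_4
    (Γ : Subgroup SL2Z) (hΓ : Γ.FiniteIndex)
    (p q : ℤ) (hpq : 0 < p + q)
    (z w : ℂ) (hz : z.im ≠ 0) (hw : w.im ≠ 0)
    (h : ∀ γ : Γ, moeb (toRealM ↑γ) z ≠ w ∧ moeb (toRealM ↑γ) z ≠ conj w) :
    Summable (fun γ : Γ =>
      jFac (toRealM ↑γ) z ^ (-(p + q + 2)) * psiPQ p q (moeb (toRealM ↑γ) z) w) := by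
  exact (summable_jFac_zpow_mul_psiPQ hpq hz hw).comp_injective
    (i := fun γ : Γ => (γ : SL2Z)) Subtype.val_injective
end
end

section
/- Let Γ be a finite-index subgroup of SL₂(ℤ), k ≥ 1 an integer, z ∈ ℂ∖ℝ, and u, v ∈ ℂ. Let w ∈ ℂ∖ℝ satisfy γ·z ∉ {w, conj w} for every γ ∈ Γ, and define F(w) = Σ_{p+q=k, p,q≥0} Ψ_Γ^{p,q}(z,w)·(u − w·v)^{p}·(u − conj(w)·v)^{q}. Then F has at w the ℝ-Fréchet derivative ν ↦ Φ_{Γ,k+2}(z,w)·(u − w·v)^{k}·ν − Φ_{Γ,k+2}(z, conj w)·(u − conj(w)·v)^{k}·conj(ν). -/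
/- STATEMENT 9: The generating function `Ψ_{Γ,k}(z,·)`, viewed as a function of
`w`, is a harmonic lift of the reproducing kernel `Φ_{Γ,k+2}`: its ℝ-Fréchet
derivative at `w` is `ν ↦ Φ_{Γ,k+2}(z,w)(u − wv)^k·ν − Φ_{Γ,k+2}(z, conj w)(u − conj(w)v)^k·conj ν`. -/

open Complex ComplexConjugate

noncomputable section

/-- The meromorphic Poincaré series `Ψ_Γ^{p,q}(z,w)`. -/
def PsiS (Γ : Subgroup SL2Z) (p q : ℤ) (z w : ℂ) : ℂ :=
  ∑' γ : Γ, jFac (toRealM ↑γ) z ^ (-(p + q + 2)) * psiPQ p q (moeb (toRealM ↑γ) z) w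

/-- The reproducing kernel `Φ_{Γ,m}(z,w) = (m−1)·Σ_γ j_γ(z)^{−m}·(γ·z − w)^{−m}`. -/
def PhiS (Γ : Subgroup SL2Z) (m : ℕ) (z w : ℂ) : ℂ :=
  ((m : ℂ) - 1) *
    ∑' γ : Γ, jFac (toRealM ↑γ) z ^ (-(m : ℤ)) * (moeb (toRealM ↑γ) z - w) ^ (-(m : ℤ))

lemma det_toRealM (γ : SL2Z) :
    toRealM γ 0 0 * toRealM γ 1 1 - toRealM γ 0 1 * toRealM γ 1 0 = 1 := by
  have h := γ.det_coe
  rw [Matrix.det_fin_two] at h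
  simp only [toRealM, Matrix.map_apply]
  exact_mod_cast h

lemma jFac_ne_zero (γ : SL2Z) {z : ℂ} (hz : z.im ≠ 0) : jFac (toRealM γ) z ≠ 0 := by
  intro h
  have hd := det_toRealM γ
  have him := congrArg Complex.im h
  have hre := congrArg Complex.re h
  simp only [jFac, add_im, mul_im, ofReal_re, ofReal_im, zero_mul, add_zero, zero_im,
    mul_eq_zero, hz, or_false, add_re, mul_re, sub_zero, zero_re] at him hre
  simp only [him, zero_mul, zero_add] at hre
  simp [him, hre] at hd

lemma moeb_im_mul (γ : SL2Z) {z : ℂ} (hz : z.im ≠ 0) :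
    (moeb (toRealM γ) z).im * ‖jFac (toRealM γ) z‖ ^ 2 = z.im := by
  have hj := jFac_ne_zero γ hz
  have hd := det_toRealM γ
  have hn : normSq (jFac (toRealM γ) z) ≠ 0 := by simpa using hj
  rw [← normSq_eq_norm_sq]
  change (_ / jFac (toRealM γ) z).im * _ = _
  rw [div_im, sub_mul, div_mul_cancel₀ _ hn, div_mul_cancel₀ _ hn]
  simp only [jFac, add_im, mul_im, ofReal_re, ofReal_im, zero_mul, add_zero, add_re, mul_re,
    sub_zero]
  linear_combination z.im * hd

/-- Two elements of `SL₂(ℤ)` with the same bottom row differ by an integral translation. -/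
lemma exists_moeb_eq_add {γ δ : SL2Z} (h : γ.val 1 = δ.val 1) {z : ℂ} (hz : z.im ≠ 0) :
    ∃ n : ℤ, γ.val 0 = δ.val 0 + n • δ.val 1 ∧
      moeb (toRealM γ) z = moeb (toRealM δ) z + n := by
  have hγ := γ.det_coe
  have hδ := δ.det_coe
  rw [Matrix.det_fin_two] at hγ hδ
  have h0 : γ.val 1 0 = δ.val 1 0 := congrFun h 0
  have h1 : γ.val 1 1 = δ.val 1 1 := congrFun h 1
  rw [h0, h1] at hγ
  have hrow : γ.val 0 = δ.val 0 +
      (γ.val 0 1 * δ.val 0 0 - γ.val 0 0 * δ.val 0 1) • δ.val 1 := by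
    ext i
    fin_cases i
    · simp
      linear_combination δ.val 0 0 * hγ - γ.val 0 0 * hδ
    · simp
      linear_combination δ.val 0 1 * hγ - γ.val 0 1 * hδ
  refine ⟨_, hrow, ?_⟩
  generalize γ.val 0 1 * δ.val 0 0 - γ.val 0 0 * δ.val 0 1 = n at hrow ⊢
  have hj := jFac_ne_zero δ hz
  have r0 := congrFun hrow 0
  have r1 := congrFun hrow 1
  simp only [jFac, toRealM, moeb, Matrix.map_apply, h0, h1] at hj ⊢
  rw [r0, r1]
  rw [div_add' _ _ _ hj]
  congr 1
  push_cast [Pi.add_apply, Pi.smul_apply, smul_eq_mul]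
  ring

lemma bottomRow_floor_injective {z : ℂ} (hz : z.im ≠ 0) :
    Function.Injective fun γ : SL2Z => (γ.val 1, ⌊(moeb (toRealM γ) z).re⌋) := by
  intro γ δ h
  obtain ⟨h1, h2⟩ := Prod.ext_iff.mp h
  obtain ⟨n, hrow, hn⟩ := exists_moeb_eq_add h1 hz
  have h3 : ⌊(moeb (toRealM γ) z).re⌋ = ⌊(moeb (toRealM δ) z).re⌋ := h2
  rw [hn] at h3
  simp only [add_re, intCast_re, Int.floor_add_intCast, add_eq_left] at h3
  apply Subtype.ext
  ext i j
  fin_cases i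
  · simp [hrow, h3]
  · exact congrFun h1 j

lemma summable_bottomRow {m : ℕ} (hm : 3 ≤ m) {z : ℂ} (hz : z.im ≠ 0) :
    Summable fun v : Fin 2 → ℤ => (‖(v 0 : ℂ) * z + v 1‖ ^ m)⁻¹ := by
  have key : ∀ τ : UpperHalfPlane,
      Summable fun v : Fin 2 → ℤ => (‖(v 0 : ℂ) * τ + v 1‖ ^ m)⁻¹ := fun τ => by
    have := EisensteinSeries.summable_norm_eisSummand (k := m) (by exact_mod_cast hm) τ
    simpa [EisensteinSeries.eisSummand, zpow_neg] using this
  rcases hz.lt_or_gt with h | h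
  · have := key ⟨conj z, by simpa using h⟩
    refine this.congr fun v => ?_
    rw [← Complex.norm_conj]
    simp
  · exact key ⟨z, h⟩

/-- The majorant of all the series below converges. -/
lemma summable_majorant {m : ℕ} (hm : 3 ≤ m) {z : ℂ} (hz : z.im ≠ 0) :
    Summable fun γ : SL2Z =>
      ((‖jFac (toRealM γ) z‖ * (1 + |(moeb (toRealM γ) z).re|)) ^ m)⁻¹ := by
  have h1 : Summable fun n : ℤ => (|(n : ℝ) + 1 / 2| ^ m)⁻¹ := by
    have := (Real.summable_one_div_int_add_rpow (1 / 2) m).mpr (by norm_cast; lia)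
    simpa [Real.rpow_natCast] using this
  have h2 := ((summable_bottomRow hm hz).mul_of_nonneg h1 (fun _ => by positivity)
    (fun _ => by positivity)).comp_injective (bottomRow_floor_injective hz)
  refine h2.of_nonneg_of_le (fun _ => by positivity) fun γ => ?_
  have hf1 := Int.floor_le (moeb (toRealM γ) z).re
  have hf2 := Int.lt_floor_add_one (moeb (toRealM γ) z).re
  have hpos : 0 < |(⌊(moeb (toRealM γ) z).re⌋ : ℝ) + 1 / 2| := by
    rw [abs_pos]
    intro h
    have : (2 * ⌊(moeb (toRealM γ) z).re⌋ + 1 : ℝ) = 0 := by linarith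
    norm_cast at this
    lia
  rw [mul_pow, mul_inv]
  have hj : ‖jFac (toRealM γ) z‖ = ‖(γ.val 1 0 : ℂ) * z + γ.val 1 1‖ := by
    simp [jFac, toRealM]
  rw [hj]
  simp only [Function.comp_apply]
  gcongr
  generalize (moeb (toRealM γ) z).re = r at *
  rw [abs_le]
  constructor <;> [have := neg_abs_le r; have := le_abs_self r] <;> linarith

lemma exists_le_norm_moeb_sub (Γ : Subgroup SL2Z) {z w : ℂ} (hz : z.im ≠ 0) (hw : w.im ≠ 0)
    (h : ∀ γ : Γ, moeb (toRealM ↑γ) z ≠ w) :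
    ∃ δ > 0, ∀ γ : Γ, δ ≤ ‖moeb (toRealM ↑γ) z - w‖ := by
  have hw' : 0 < |w.im| := abs_pos.mpr hw
  set R : ℝ := 1 + |w.re| + |w.im| with hR
  set C : ℝ := Real.sqrt (2 * |z.im| / |w.im|) with hC
  have hC0 : 0 < C := Real.sqrt_pos.mpr (by have := abs_pos.mpr hz; positivity)
  have hsum := (summable_majorant (m := 3) le_rfl hz).comp_injective
    (Subtype.val_injective (p := (· ∈ Γ)))
  have hfin := hsum.tendsto_cofinite_zero.eventually_lt_const
    (show (0 : ℝ) < ((C * R) ^ 3)⁻¹ by positivity)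
  rw [Filter.eventually_cofinite] at hfin
  obtain ⟨δ, hδ, hle⟩ : ∃ δ > 0, ∀ γ ∈ hfin.toFinset, δ ≤ ‖moeb (toRealM ↑γ) z - w‖ := by
    rcases hfin.toFinset.eq_empty_or_nonempty with he | hne
    · exact ⟨1, one_pos, fun γ hγ => by rw [he] at hγ; exact absurd hγ (Finset.notMem_empty γ)⟩
    · obtain ⟨γ, -, hγ⟩ := hfin.toFinset.exists_min_image
        (fun γ : Γ => ‖moeb (toRealM ↑γ) z - w‖) hne
      exact ⟨_, norm_pos_iff.mpr (sub_ne_zero.mpr (h γ)), hγ⟩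
  refine ⟨min δ (|w.im| / 2), by positivity, fun γ => ?_⟩
  by_contra! hlt
  obtain ⟨hlt1, hlt2⟩ := lt_min_iff.mp hlt
  refine hlt1.not_ge (hle γ ?_)
  rw [Set.Finite.mem_toFinset, Set.mem_ofPred_eq, not_lt]
  have hj := jFac_ne_zero γ.1 hz
  have hre := (abs_re_le_norm (moeb (toRealM ↑γ) z - w)).trans hlt2.le
  have him := (abs_im_le_norm (moeb (toRealM ↑γ) z - w)).trans hlt2.le
  rw [sub_re] at hre
  rw [sub_im] at him
  have hre' : |(moeb (toRealM ↑γ) z).re| ≤ |w.re| + |w.im| := by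
    have := abs_sub_abs_le_abs_sub (moeb (toRealM ↑γ) z).re w.re
    linarith
  have him' : |w.im| / 2 ≤ |(moeb (toRealM ↑γ) z).im| := by
    have := abs_sub_abs_le_abs_sub w.im (moeb (toRealM ↑γ) z).im
    rw [abs_sub_comm] at this
    linarith
  have hjC : ‖jFac (toRealM ↑γ) z‖ ≤ C := by
    apply Real.le_sqrt_of_sq_le
    have := congrArg abs (moeb_im_mul γ.1 hz)
    rw [abs_mul, abs_pow, abs_norm] at this
    rw [← this, le_div_iff₀ hw']
    nlinarith [sq_nonneg ‖jFac (toRealM ↑γ) z‖]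
  have hjpos := norm_pos_iff.mpr hj
  simp only [Function.comp_apply]
  have : 1 + |(moeb (toRealM ↑γ) z).re| ≤ R := by rw [hR]; linarith
  gcongr

/-- Away from its orbit, a point has a neighbourhood whose distance to `γ·z` is bounded below,
linearly in `|Re γ·z|`. -/
lemma exists_ball_moeb_bound (Γ : Subgroup SL2Z) {z w : ℂ} (hz : z.im ≠ 0) (hw : w.im ≠ 0)
    (h : ∀ γ : Γ, moeb (toRealM ↑γ) z ≠ w) :
    ∃ ε > 0, ∃ K > 0, ∀ γ : Γ, ∀ ω ∈ Metric.ball w ε,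
      1 + |(moeb (toRealM ↑γ) z).re| ≤ K * ‖moeb (toRealM ↑γ) z - ω‖ := by
  obtain ⟨δ, hδ, hle⟩ := exists_le_norm_moeb_sub Γ hz hw h
  refine ⟨δ / 2, by positivity, (1 + ‖w‖ + δ) / (δ / 2) + 1, by positivity, fun γ ω hω => ?_⟩
  rw [mem_ball_iff_norm'] at hω
  set x := moeb (toRealM ↑γ) z
  have h1 : δ / 2 ≤ ‖x - ω‖ := by
    have := norm_sub_le_norm_sub_add_norm_sub x ω w
    rw [norm_sub_rev ω w] at this
    linarith [hle γ]
  have h2 : ‖ω‖ ≤ ‖w‖ + δ := by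
    have := norm_le_norm_add_norm_sub w ω
    linarith
  have h3 : ‖x‖ ≤ ‖ω‖ + ‖x - ω‖ := by
    have := norm_le_norm_add_norm_sub ω x
    rwa [norm_sub_rev] at this
  have h4 : 1 + ‖w‖ + δ ≤ (1 + ‖w‖ + δ) / (δ / 2) * ‖x - ω‖ := by
    rw [div_mul_eq_mul_div, le_div_iff₀ (by positivity)]
    gcongr
  have := abs_re_le_norm x
  linarith

lemma hasFDerivAt_wirt_sub {f g : ℂ → ℂ} {a b w : ℂ} (hf : HasDerivAt f a w)
    (hg : HasDerivAt g b (conj w)) :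
    HasFDerivAt (fun ω => f ω - g (conj ω)) (wirt a (-b)) w := by
  have h1 := hf.hasFDerivAt.restrictScalars ℝ
  have h2 := (hg.hasFDerivAt.restrictScalars ℝ).comp w
    (Complex.conjCLE.toContinuousLinearMap.hasFDerivAt (x := w))
  refine (h1.sub h2).congr_fderiv ?_
  ext
  simp [wirt, mul_comm, sub_eq_add_neg]

/-- Contribution of an orbit point `x` to the generating function, without automorphy factor. -/
lemma hasFDerivAt_sum_psiPQ (k : ℕ) (u v x : ℂ) {w : ℂ} (h1 : x ≠ w) (h2 : x ≠ conj w) :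
    HasFDerivAt (fun ω : ℂ => ∑ p ∈ Finset.range (k + 1),
        psiPQ (p : ℤ) ((k - p : ℕ) : ℤ) x ω * (u - ω * v) ^ p * (u - conj ω * v) ^ (k - p))
      (wirt ((k + 1) * (u - w * v) ^ k / (x - w) ^ (k + 2))
        (-((k + 1) * (u - conj w * v) ^ k / (x - conj w) ^ (k + 2)))) w := by
  have hev : ∀ᶠ ω in nhds w, x ≠ ω ∧ x ≠ conj ω :=
    ((eventually_ne_nhds h1.symm).mono fun _ => Ne.symm).and
      ((continuous_conj.continuousAt.eventually_ne h2.symm).mono fun _ => Ne.symm)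
  have hterm : ∀ ω : ℂ, x ≠ ω → x ≠ conj ω → ∑ p ∈ Finset.range (k + 1),
      psiPQ (p : ℤ) ((k - p : ℕ) : ℤ) x ω * (u - ω * v) ^ p * (u - conj ω * v) ^ (k - p) =
      ((x - ω)⁻¹ - (x - conj ω)⁻¹) * ∑ p ∈ Finset.range (k + 1),
        ((u - ω * v) / (x - ω)) ^ p * ((u - conj ω * v) / (x - conj ω)) ^ (k - p) := by
    intro ω hω hω'
    rw [Finset.mul_sum]
    refine Finset.sum_congr rfl fun p _ => ?_
    have e1 := sub_ne_zero.mpr hω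
    have e2 := sub_ne_zero.mpr hω'
    simp only [psiPQ]
    norm_cast
    rw [inv_sub_inv e1 e2]
    rw [div_pow, div_pow]
    field_simp
    ring
  have hd : ∀ y : ℂ, x ≠ y → HasDerivAt (fun ω => (x - ω)⁻¹) (1 / (x - y) ^ 2) y := by
    intro y hy
    simpa using ((hasDerivAt_id y).const_sub x).fun_inv (sub_ne_zero.mpr hy)
  by_cases hc : u - x * v = 0
  · have hd' : ∀ y : ℂ, x ≠ y → HasDerivAt (fun ω => (k + 1) * v ^ k * (x - ω)⁻¹)
        ((k + 1) * (u - y * v) ^ k / (x - y) ^ (k + 2)) y := by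
      intro y hy
      refine ((hd y hy).const_mul _).congr_deriv ?_
      have e1 := sub_ne_zero.mpr hy
      have : u - y * v = (x - y) * v := by linear_combination hc
      rw [this, mul_pow]
      field_simp
      ring
    refine (hasFDerivAt_wirt_sub (hd' w h1) (hd' _ h2)).congr_of_eventuallyEq ?_
    filter_upwards [hev] with ω hω
    have e1 := sub_ne_zero.mpr hω.1
    have e2 := sub_ne_zero.mpr hω.2
    have a1 : (u - ω * v) / (x - ω) = v := by
      rw [div_eq_iff e1]; linear_combination hc
    have a2 : (u - conj ω * v) / (x - conj ω) = v := by
      rw [div_eq_iff e2]; linear_combination hc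
    rw [hterm ω hω.1 hω.2, a1, a2, Finset.sum_congr rfl fun p hp => by
      rw [← pow_add, Nat.add_sub_cancel' (Finset.mem_range_succ_iff.mp hp)]]
    simp
    ring
  · have hd' : ∀ y : ℂ, x ≠ y →
        HasDerivAt (fun ω => ((u - ω * v) / (x - ω)) ^ (k + 1) / (u - x * v))
        ((k + 1) * (u - y * v) ^ k / (x - y) ^ (k + 2)) y := by
      intro y hy
      have e1 := sub_ne_zero.mpr hy
      have q := (((((hasDerivAt_id y).mul_const v).const_sub u).fun_div
        ((hasDerivAt_id y).const_sub x) e1).fun_pow (k + 1)).div_const (u - x * v)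
      refine q.congr_deriv ?_
      simp only [id_eq]
      push_cast
      rw [div_pow, show -(1 * v) * (x - y) - (u - y * v) * -1 = u - x * v by ring,
        ← mul_div_assoc, div_right_comm, mul_div_cancel_right₀ _ hc]
      field_simp
      ring
    refine (hasFDerivAt_wirt_sub (hd' w h1) (hd' _ h2)).congr_of_eventuallyEq ?_
    filter_upwards [hev] with ω hω
    have e1 := sub_ne_zero.mpr hω.1
    have e2 := sub_ne_zero.mpr hω.2
    have hAB : ((u - ω * v) / (x - ω) - (u - conj ω * v) / (x - conj ω)) =
        ((x - ω)⁻¹ - (x - conj ω)⁻¹) * (u - x * v) := by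
      field_simp
      ring
    have hg := (Commute.all ((u - ω * v) / (x - ω))
      ((u - conj ω * v) / (x - conj ω))).mul_geom_sum₂ (k + 1)
    rw [hterm ω hω.1 hω.2, ← sub_div, eq_div_iff hc, ← hg, hAB, Nat.add_sub_cancel]
    ring

lemma norm_wirt_le (a b : ℂ) : ‖wirt a b‖ ≤ ‖a‖ + ‖b‖ := by
  refine ContinuousLinearMap.opNorm_le_bound _ (by positivity) fun ν => ?_
  calc ‖wirt a b ν‖ = ‖a * ν + b * conj ν‖ := by simp [wirt]
    _ ≤ ‖a * ν‖ + ‖b * conj ν‖ := norm_add_le _ _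
    _ = (‖a‖ + ‖b‖) * ‖ν‖ := by rw [norm_mul, norm_mul, norm_conj]; ring

lemma inv_pow_mul_pow_le {r s t K : ℝ} (hr : 0 < r) (hK : 0 < K) (hs : r ≤ K * s)
    (ht : r ≤ K * t) (a b : ℕ) : (s ^ a * t ^ b)⁻¹ ≤ K ^ (a + b) * (r ^ (a + b))⁻¹ := by
  have hs' : r / K ≤ s := by rwa [div_le_iff₀' hK]
  have ht' : r / K ≤ t := by rwa [div_le_iff₀' hK]
  rw [← div_eq_mul_inv, ← inv_div, ← div_pow, pow_add]
  have : 0 < r / K := by positivity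
  have : 0 < s := by linarith
  gcongr

lemma smul_wirt (c a b : ℂ) : c • wirt a b = wirt (c * a) (c * b) := by
  simp [wirt, smul_smul]

lemma HasSum.wirt {ι : Type*} {f g : ι → ℂ} {a b : ℂ} (hf : HasSum f a) (hg : HasSum g b) :
    HasSum (fun i => _root_.wirt (f i) (g i)) (_root_.wirt a b) :=
  (hf.smul_const _).add (hg.smul_const _)

theorem statement_9
    (Γ : Subgroup SL2Z) (hΓ : Γ.FiniteIndex) (k : ℕ) (hk : 1 ≤ k)
    (z : ℂ) (hz : z.im ≠ 0) (u v : ℂ) (w : ℂ) (hw : w.im ≠ 0)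
    (h : ∀ γ : Γ, moeb (toRealM ↑γ) z ≠ w ∧ moeb (toRealM ↑γ) z ≠ conj w) :
    HasFDerivAt
      (fun ω : ℂ => ∑ p ∈ Finset.range (k + 1),
        PsiS Γ (p : ℤ) ((k - p : ℕ) : ℤ) z ω * (u - ω * v) ^ p * (u - conj ω * v) ^ (k - p))
      (wirt (PhiS Γ (k + 2) z w * (u - w * v) ^ k)
        (-(PhiS Γ (k + 2) z (conj w)) * (u - conj w * v) ^ k)) w := by
  obtain ⟨ε₁, hε₁, K₁, hK₁, hb₁⟩ := exists_ball_moeb_bound Γ hz hw fun γ => (h γ).1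
  obtain ⟨ε₂, hε₂, K₂, hK₂, hb₂⟩ := exists_ball_moeb_bound Γ hz (w := conj w)
    (by simpa using hw) fun γ => (h γ).2
  set ε := min ε₁ ε₂
  set K := max K₁ K₂
  have hεpos : 0 < ε := lt_min hε₁ hε₂
  have hKpos : 0 < K := lt_max_of_lt_left hK₁
  set x : Γ → ℂ := fun γ => moeb (toRealM ↑γ) z with hx
  set c : Γ → ℂ := fun γ => jFac (toRealM ↑γ) z ^ (-((k + 2 : ℕ) : ℤ)) with hc
  set B : Γ → ℝ := fun γ => ‖c γ‖ * ((1 + |(x γ).re|) ^ (k + 2))⁻¹ with hBdef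
  have hB : Summable B := by
    refine ((summable_majorant (m := k + 2) (by lia) hz).comp_injective
      (Subtype.val_injective (p := (· ∈ Γ)))).congr fun γ => ?_
    simp only [Function.comp_apply, hBdef, hc, hx]
    rw [mul_pow, mul_inv, norm_zpow, zpow_neg, zpow_natCast]
  have hb : ∀ γ : Γ, ∀ ω ∈ Metric.ball w ε,
      1 + |(x γ).re| ≤ K * ‖x γ - ω‖ ∧ 1 + |(x γ).re| ≤ K * ‖x γ - conj ω‖ := by
    intro γ ω hω
    have hω' : conj ω ∈ Metric.ball (conj w) ε := by
      rw [mem_ball_iff_norm] at hω ⊢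
      rwa [← map_sub, norm_conj]
    constructor
    · refine (hb₁ γ ω (Metric.ball_subset_ball (min_le_left _ _) hω)).trans ?_
      gcongr
      exact le_max_left _ _
    · refine (hb₂ γ _ (Metric.ball_subset_ball (min_le_right _ _) hω')).trans ?_
      gcongr
      exact le_max_right _ _
  have hpos : ∀ γ, 0 < 1 + |(x γ).re| := fun γ => by positivity
  have hne : ∀ γ : Γ, ∀ ω ∈ Metric.ball w ε, x γ ≠ ω ∧ x γ ≠ conj ω := by
    intro γ ω hω
    have h0 := hpos γ
    constructor <;> intro he
    · have := (hb γ ω hω).1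
      rw [sub_eq_zero.mpr he, norm_zero, mul_zero] at this
      linarith
    · have := (hb γ ω hω).2
      rw [sub_eq_zero.mpr he, norm_zero, mul_zero] at this
      linarith
  have hbound : ∀ γ : Γ, ∀ y y' : ℂ, 1 + |(x γ).re| ≤ K * ‖x γ - y‖ →
      1 + |(x γ).re| ≤ K * ‖x γ - y'‖ → ∀ a b : ℕ, a + b = k + 2 →
      ‖c γ‖ * (‖x γ - y‖ ^ a * ‖x γ - y'‖ ^ b)⁻¹ ≤ K ^ (k + 2) * B γ := by
    intro γ y y' hy hy' a b hab
    have := inv_pow_mul_pow_le (hpos γ) hKpos hy hy' a b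
    rw [hab] at this
    calc _ ≤ ‖c γ‖ * (K ^ (k + 2) * ((1 + |(x γ).re|) ^ (k + 2))⁻¹) := by gcongr
      _ = _ := by ring
  have hpsi : ∀ ω ∈ Metric.ball w ε, ∀ p ∈ Finset.range (k + 1),
      HasSum (fun γ => c γ * psiPQ (p : ℤ) ((k - p : ℕ) : ℤ) (x γ) ω)
        (PsiS Γ (p : ℤ) ((k - p : ℕ) : ℤ) z ω) := by
    intro ω hω p hp
    have hp' := Finset.mem_range_succ_iff.mp hp
    have hexp : (p : ℤ) + ((k - p : ℕ) : ℤ) + 2 = ((k + 2 : ℕ) : ℤ) := by lia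
    have hs : Summable (fun γ => c γ * psiPQ (p : ℤ) ((k - p : ℕ) : ℤ) (x γ) ω) := by
      refine Summable.of_norm_bounded ((hB.mul_left (K ^ (k + 2))).mul_left ‖ω - conj ω‖)
        fun γ => ?_
      have := hbound γ ω (conj ω) (hb γ ω hω).1 (hb γ ω hω).2 (p + 1) (k - p + 1) (by lia)
      calc _ = ‖ω - conj ω‖ *
            (‖c γ‖ * (‖x γ - ω‖ ^ (p + 1) * ‖x γ - conj ω‖ ^ (k - p + 1))⁻¹) := by
            simp only [psiPQ]
            norm_cast
            rw [norm_mul, norm_div, norm_mul, norm_pow, norm_pow]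
            ring
        _ ≤ _ := by gcongr
    have := hs.hasSum
    simp only [PsiS, hexp]
    exact this
  set f : Γ → ℂ → ℂ := fun γ ω => c γ * ∑ p ∈ Finset.range (k + 1),
    psiPQ (p : ℤ) ((k - p : ℕ) : ℤ) (x γ) ω * (u - ω * v) ^ p * (u - conj ω * v) ^ (k - p) with hf
  set D : Γ → ℂ → ℂ := fun γ ω => c γ * ((k + 1) * (u - ω * v) ^ k / (x γ - ω) ^ (k + 2)) with hD
  have hfsum : ∀ ω ∈ Metric.ball w ε, HasSum (f · ω) (∑ p ∈ Finset.range (k + 1),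
      PsiS Γ (p : ℤ) ((k - p : ℕ) : ℤ) z ω * (u - ω * v) ^ p * (u - conj ω * v) ^ (k - p)) := by
    intro ω hω
    have := (hasSum_sum fun p hp => ((hpsi ω hω p hp).mul_right ((u - ω * v) ^ p)).mul_right
      ((u - conj ω * v) ^ (k - p)))
    simpa only [hf, Finset.mul_sum, mul_assoc] using this
  have hfder : ∀ γ : Γ, ∀ ω ∈ Metric.ball w ε,
      HasFDerivAt (f γ) (wirt (D γ ω) (-D γ (conj ω))) ω := by
    intro γ ω hω
    have := (hasFDerivAt_sum_psiPQ k u v (x γ) (hne γ ω hω).1 (hne γ ω hω).2).const_mul (c γ)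
    rwa [smul_wirt, mul_neg] at this
  set M : ℝ := (k + 1) * (‖u‖ + (‖w‖ + ε) * ‖v‖) ^ k * K ^ (k + 2)
  have hDbound : ∀ γ : Γ, ∀ y : ℂ, ‖y‖ ≤ ‖w‖ + ε → 1 + |(x γ).re| ≤ K * ‖x γ - y‖ →
      ‖D γ y‖ ≤ M * B γ := by
    intro γ y hy hy'
    have h1 := hbound γ y y hy' hy' (k + 2) 0 rfl
    rw [pow_zero, mul_one] at h1
    have h2 : ‖u - y * v‖ ≤ ‖u‖ + (‖w‖ + ε) * ‖v‖ := by
      refine (norm_sub_le _ _).trans ?_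
      rw [norm_mul]
      gcongr
    have h3 : ‖(k + 1 : ℂ)‖ = k + 1 := by exact_mod_cast norm_natCast (k + 1)
    calc ‖D γ y‖ = (k + 1) * ‖u - y * v‖ ^ k * (‖c γ‖ * (‖x γ - y‖ ^ (k + 2))⁻¹) := by
          simp only [hD, norm_mul, norm_div, norm_pow, h3]
          ring
      _ ≤ (k + 1) * (‖u‖ + (‖w‖ + ε) * ‖v‖) ^ k * (K ^ (k + 2) * B γ) := by gcongr
      _ = M * B γ := by ring
  have hnorm : ∀ ω ∈ Metric.ball w ε, ‖ω‖ ≤ ‖w‖ + ε := by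
    intro ω hω
    rw [mem_ball_iff_norm'] at hω
    have := norm_le_norm_add_norm_sub w ω
    linarith
  have hDb1 : ∀ γ, ∀ ω ∈ Metric.ball w ε, ‖D γ ω‖ ≤ M * B γ := fun γ ω hω =>
    hDbound γ ω (hnorm ω hω) (hb γ ω hω).1
  have hDb2 : ∀ γ, ∀ ω ∈ Metric.ball w ε, ‖D γ (conj ω)‖ ≤ M * B γ := fun γ ω hω =>
    hDbound γ _ (by rw [norm_conj]; exact hnorm ω hω) (hb γ ω hω).2
  have hw0 := Metric.mem_ball_self (x := w) hεpos
  have hDsum : ∀ y : ℂ, (∀ γ, ‖D γ y‖ ≤ M * B γ) →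
      HasSum (D · y) (PhiS Γ (k + 2) z y * (u - y * v) ^ k) := by
    intro y hy
    have hs : Summable (D · y) := Summable.of_norm_bounded (hB.mul_left M) hy
    have hv : ∑' γ, D γ y = PhiS Γ (k + 2) z y * (u - y * v) ^ k := by
      rw [PhiS, mul_right_comm, ← tsum_mul_left]
      refine tsum_congr fun γ => ?_
      simp only [hD, hc, hx, zpow_neg, zpow_natCast]
      push_cast
      ring
    exact hv ▸ hs.hasSum
  have hmain := hasFDerivAt_tsum_of_isPreconnected ((hB.mul_left M).add (hB.mul_left M))
    Metric.isOpen_ball (convex_ball w ε).isPreconnected hfder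
    (fun γ ω hω => (norm_wirt_le _ _).trans
      (add_le_add (hDb1 γ ω hω) (by rw [norm_neg]; exact hDb2 γ ω hω)))
    hw0 (hfsum w hw0).summable hw0
  rw [((hDsum w (hDb1 · w hw0)).wirt (hDsum (conj w) (hDb2 · w hw0)).neg).tsum_eq,
    ← neg_mul] at hmain
  refine hmain.congr_of_eventuallyEq ?_
  filter_upwards [Metric.ball_mem_nhds w hεpos] with ω hω
  exact (hfsum ω hω).tsum_eq.symm
end
end

section
/- Let k ≥ 0 be an integer and let w, u, v, x, y ∈ ℂ with u − w·v ≠ 0. Then there exists ε₀ > 0 such that for every 0 < ε < ε₀, the integral over the circle of radius ε centred at w satisfies (1/(2πi))·∮_{|z−w|=ε} (u − w·v)^{k+1}·(x − z·y)^{k} / ((z − w)^{k+1}·(u − z·v)) dz = (x·v − y·u)^{k}. -/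
/- STATEMENT 10: The residue computation behind Theorem on the residue of
`Ψ_{Γ,k}(z,w)(X−zY)^k dz`: for small `ε > 0`,
`(1/(2πi))·∮_{|z−w|=ε} (u − wv)^{k+1}(x − zy)^k/((z − w)^{k+1}(u − zv)) dz = (xv − yu)^k`. -/

open Complex

noncomputable section

theorem sub_ne_zero_of_mem_sphere_of_pos {w z : ℂ} {ε : ℝ} (hε : 0 < ε)
    (hz : z ∈ Metric.sphere w ε) : z - w ≠ 0 :=
  sub_ne_zero.2 (Metric.ne_of_mem_sphere hz hε.ne')

theorem circleIntegrable_linear_pow_div_pow (w x y : ℂ) {ε : ℝ} (hε : 0 < ε) (k n : ℕ) :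
    CircleIntegrable (fun z => (x - z * y) ^ k / (z - w) ^ n) w ε := by
  refine ContinuousOn.circleIntegrable hε.le (ContinuousOn.div (by fun_prop) (by fun_prop) ?_)
  exact fun z hz => pow_ne_zero _ (sub_ne_zero_of_mem_sphere_of_pos hε hz)

/-- A polynomial of degree `k` divided by `(z - w) ^ n` with `n ≥ k + 2` has no residue at `w`. -/
theorem circleIntegral_linear_pow_div_pow_eq_zero (w x y : ℂ) {ε : ℝ} (hε : 0 < ε) (k m : ℕ) :
    (∮ z in C(w, ε), (x - z * y) ^ k / (z - w) ^ (k + 2 + m)) = 0 := by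
  induction k generalizing m with
  | zero =>
    have := circleIntegral.integral_sub_zpow_of_ne (n := -((0 + 2 + m : ℕ) : ℤ))
      (by omega) w w ε
    simpa only [zpow_neg, zpow_natCast, pow_zero, one_div] using this
  | succ k ih =>
    have hsplit : (∮ z in C(w, ε), (x - z * y) ^ (k + 1) / (z - w) ^ (k + 1 + 2 + m)) =
        ∮ z in C(w, ε), ((x - w * y) * ((x - z * y) ^ k / (z - w) ^ (k + 2 + (m + 1))) -
          y * ((x - z * y) ^ k / (z - w) ^ (k + 2 + m))) := by
      refine circleIntegral.integral_congr hε.le fun z hz => ?_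
      have ht := sub_ne_zero_of_mem_sphere_of_pos hε hz
      simp only [show k + 1 + 2 + m = k + 2 + m + 1 by ring, ← add_assoc, pow_succ _ (k + 2 + m)]
      field_simp
      ring
    rw [hsplit, circleIntegral.integral_sub, circleIntegral.integral_const_mul,
      circleIntegral.integral_const_mul, ih, ih, mul_zero, mul_zero, sub_zero]
    · exact (circleIntegrable_linear_pow_div_pow w x y hε k _).const_fun_smul
    · exact (circleIntegrable_linear_pow_div_pow w x y hε k _).const_fun_smul

theorem circleIntegral_residue_kernel (k : ℕ) (w u v x y : ℂ) {ε : ℝ} (hε : 0 < ε)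
    (hD : ∀ z ∈ Metric.closedBall w ε, u - z * v ≠ 0) :
    (∮ z in C(w, ε),
      (u - w * v) ^ (k + 1) * (x - z * y) ^ k / ((z - w) ^ (k + 1) * (u - z * v))) =
    2 * Real.pi * I * (x * v - y * u) ^ k := by
  have hw := hD w (Metric.mem_closedBall_self hε.le)
  induction k with
  | zero =>
    have hd : DifferentiableOn ℂ (fun z => (u - w * v) / (u - z * v)) (Metric.closedBall w ε) :=
      DifferentiableOn.div (by fun_prop) (by fun_prop) hD
    have hc := hd.circleIntegral_sub_inv_smul (Metric.mem_ball_self hε)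
    simp only [smul_eq_mul, div_self hw] at hc
    rw [pow_zero, ← hc]
    congr 1
    ext z
    simp only [div_eq_mul_inv, mul_inv]
    ring
  | succ k ih =>
    have hsplit : (∮ z in C(w, ε), (u - w * v) ^ (k + 1 + 1) * (x - z * y) ^ (k + 1) /
          ((z - w) ^ (k + 1 + 1) * (u - z * v))) =
        ∮ z in C(w, ε), ((x * v - y * u) * ((u - w * v) ^ (k + 1) * (x - z * y) ^ k /
            ((z - w) ^ (k + 1) * (u - z * v))) +
          (u - w * v) ^ (k + 1) * (x - w * y) * ((x - z * y) ^ k / (z - w) ^ (k + 2 + 0))) := by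
      refine circleIntegral.integral_congr hε.le fun z hz => ?_
      have ht := sub_ne_zero_of_mem_sphere_of_pos hε hz
      have hzv := hD z (Metric.sphere_subset_closedBall hz)
      have hvz : u - v * z ≠ 0 := mul_comm z v ▸ hzv
      simp only [add_zero]
      field_simp
      ring
    rw [hsplit, circleIntegral.integral_add, circleIntegral.integral_const_mul,
      circleIntegral.integral_const_mul, ih, circleIntegral_linear_pow_div_pow_eq_zero w x y hε]
    · ring
    · refine CircleIntegrable.const_fun_smul (ContinuousOn.circleIntegrable hε.le
        (ContinuousOn.div (by fun_prop) (by fun_prop) fun z hz => ?_))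
      exact mul_ne_zero (pow_ne_zero _ (sub_ne_zero_of_mem_sphere_of_pos hε hz))
        (hD z (Metric.sphere_subset_closedBall hz))
    · exact (circleIntegrable_linear_pow_div_pow w x y hε k _).const_fun_smul

theorem statement_10 (k : ℕ) (w u v x y : ℂ) (h : u - w * v ≠ 0) :
    ∃ ε₀ > (0 : ℝ), ∀ ε : ℝ, 0 < ε → ε < ε₀ →
      (1 / (2 * (Real.pi : ℂ) * Complex.I)) *
          (∮ z in C(w, ε),
            (u - w * v) ^ (k + 1) * (x - z * y) ^ k / ((z - w) ^ (k + 1) * (u - z * v))) =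
        (x * v - y * u) ^ k := by
  have hcont : ContinuousAt (fun z : ℂ => u - z * v) w := by fun_prop
  obtain ⟨ε₀, hε₀, hball⟩ := Metric.eventually_nhds_iff_ball.1 (hcont.eventually_ne h)
  refine ⟨ε₀, hε₀, fun ε hε hlt => ?_⟩
  rw [circleIntegral_residue_kernel k w u v x y hε
    fun z hz => hball z (Metric.closedBall_subset_ball hlt hz), ← mul_assoc,
    one_div_mul_cancel two_pi_I_ne_zero, one_mul]
end
end

section
/- Let p, q ≥ 0 be integers, set k = p + q, and let w, w', x, y ∈ ℂ with w ≠ w'. Then there exists ε₀ > 0 such that for every 0 < ε < ε₀, the integral over the circle of radius ε centred at w satisfies (1/(2πi))·∮_{|z−w|=ε} (w − w')/((z − w)^{p+1}·(z − w')^{q+1})·(x − z·y)^{k} dz = (−1)^{p}·binomial(k,p)·(x − w'·y)^{p}·(x − w·y)^{q}/(w − w')^{k}. -/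
/- STATEMENT 11: The residue of the components `ψ^{p,q}(z,w)(x − zy)^{p+q}`
(with a general second point `w'` in place of `conj w`): for small `ε > 0`,
`(1/(2πi))·∮_{|z−w|=ε} (w − w')/((z−w)^{p+1}(z−w')^{q+1})·(x − zy)^{p+q} dz
  = (−1)^p·C(k,p)·(x − w'y)^p·(x − wy)^q/(w − w')^{p+q}`. -/

open Complex

noncomputable section

theorem ne_of_mem_sphere_of_lt {w w' z : ℂ} {ε : ℝ} (hε : 0 < ε) (h : ε < ‖w - w'‖)
    (hz : z ∈ Metric.sphere w ε) : z - w ≠ 0 ∧ z - w' ≠ 0 := by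
  rw [mem_sphere_iff_norm] at hz
  constructor <;> intro h0
  · rw [h0, norm_zero] at hz
    exact hε.ne hz
  · rw [sub_eq_zero.mp h0, norm_sub_rev] at hz
    exact h.ne' hz

theorem circleIntegral_zpow_mul_zpow_eq_zero {w w' : ℂ} {ε : ℝ} (hε : 0 < ε)
    (h : ε < ‖w - w'‖) {n : ℤ} (hn : n ≠ 0) :
    (∮ z in C(w, ε), (z - w) ^ (n - 1) * (z - w') ^ (-n - 1)) = 0 := by
  have hD : w - w' ≠ 0 := norm_pos_iff.mp (hε.trans h)
  have hn' : (n : ℂ) ≠ 0 := Int.cast_ne_zero.mpr hn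
  refine circleIntegral.integral_eq_zero_of_hasDerivWithinAt
    (f := fun z => ((z - w) / (z - w')) ^ n / (n * (w - w'))) hε.le fun z hz => ?_
  obtain ⟨h1, h2⟩ := ne_of_mem_sphere_of_lt hε h hz
  have hd : HasDerivAt (fun z : ℂ => (z - w) / (z - w')) ((w - w') / (z - w') ^ 2) z := by
    refine (((hasDerivAt_id z).sub_const w).div ((hasDerivAt_id z).sub_const w')
      h2).congr_deriv ?_
    simp only [id]
    ring
  have hp := ((hasDerivAt_zpow n ((z - w) / (z - w')) (Or.inl (div_ne_zero h1 h2))).comp z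
    hd).div_const (n * (w - w'))
  refine (hp.congr_deriv ?_).hasDerivWithinAt
  have e : (z - w') ^ (-n - 1) = ((z - w') ^ (n - 1))⁻¹ * ((z - w') ^ 2)⁻¹ := by
    rw [← zpow_neg, ← zpow_natCast, ← zpow_neg, ← zpow_add₀ h2]
    congr 1
    push_cast
    ring
  have h3 := zpow_ne_zero (n - 1) h2
  rw [e, div_zpow]
  field_simp

theorem circleIntegral_inv_mul_inv {w w' : ℂ} {ε : ℝ} (hε : 0 < ε) (h : ε < ‖w - w'‖) :
    (∮ z in C(w, ε), (z - w)⁻¹ * (z - w')⁻¹) = 2 * Real.pi * Complex.I * (w - w')⁻¹ := by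
  have hd : DifferentiableOn ℂ (fun z : ℂ => (z - w')⁻¹) (Metric.closedBall w ε) := by
    intro z hz
    have hz' : z - w' ≠ 0 := by
      intro h0
      rw [mem_closedBall_iff_norm, sub_eq_zero.mp h0, norm_sub_rev] at hz
      exact absurd hz h.not_ge
    fun_prop (disch := assumption)
  simpa [smul_eq_mul] using hd.circleIntegral_sub_inv_smul (Metric.mem_ball_self hε)

theorem circleIntegral_zpow_mul_zpow {w w' : ℂ} {ε : ℝ} (hε : 0 < ε)
    (h : ε < ‖w - w'‖) (n : ℤ) :
    (∮ z in C(w, ε), (z - w) ^ (n - 1) * (z - w') ^ (-n - 1)) =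
      if n = 0 then 2 * Real.pi * Complex.I * (w - w')⁻¹ else 0 := by
  split_ifs with hn
  · subst hn
    simpa using circleIntegral_inv_mul_inv hε h
  · exact circleIntegral_zpow_mul_zpow_eq_zero hε h hn

theorem circleIntegrable_zpow_mul_zpow {w w' : ℂ} {ε : ℝ} (hε : 0 < ε)
    (h : ε < ‖w - w'‖) (m n : ℤ) :
    CircleIntegrable (fun z => (z - w) ^ m * (z - w') ^ n) w ε := by
  refine ContinuousOn.circleIntegrable hε.le ?_
  exact ((continuousOn_id.sub continuousOn_const).zpow₀ m fun z hz =>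
      Or.inl (ne_of_mem_sphere_of_lt hε h hz).1).mul
    ((continuousOn_id.sub continuousOn_const).zpow₀ n fun z hz =>
      Or.inl (ne_of_mem_sphere_of_lt hε h hz).2)

/-- Expansion of the integrand, from
`(w - w') * (x - z * y) = (z - w') * (x - w * y) - (z - w) * (x - w' * y)`. -/
theorem div_mul_pow_eq_sum_zpow {w w' z : ℂ} (hD : w - w' ≠ 0) (h1 : z - w ≠ 0)
    (h2 : z - w' ≠ 0) (p q : ℕ) (x y : ℂ) :
    (w - w') / ((z - w) ^ (p + 1) * (z - w') ^ (q + 1)) * (x - z * y) ^ (p + q) =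
      ∑ m ∈ Finset.range (p + q + 1),
        ((w - w') / (w - w') ^ (p + q) * ((-(x - w' * y)) ^ m * (x - w * y) ^ (p + q - m) *
          ((p + q).choose m : ℂ))) *
          ((z - w) ^ ((m : ℤ) - p - 1) * (z - w') ^ (-((m : ℤ) - p) - 1)) := by
  have hx : x - z * y =
      ((z - w) * (-(x - w' * y)) + (z - w') * (x - w * y)) / (w - w') := by
    field_simp
    ring
  rw [hx, div_pow, add_pow, Finset.sum_div, Finset.mul_sum]
  refine Finset.sum_congr rfl fun m hm => ?_
  have hm' : m ≤ p + q := Nat.lt_succ_iff.mp (Finset.mem_range.mp hm)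
  have e1 : (z - w) ^ ((m : ℤ) - p - 1) = (z - w) ^ m / (z - w) ^ (p + 1) := by
    rw [← zpow_natCast, ← zpow_natCast, ← zpow_sub₀ h1]
    congr 1
    push_cast
    ring
  have e2 : (z - w') ^ (-((m : ℤ) - p) - 1) = (z - w') ^ (p + q - m) / (z - w') ^ (q + 1) := by
    rw [← zpow_natCast, ← zpow_natCast, ← zpow_sub₀ h2]
    congr 1
    push_cast [Nat.cast_sub hm']
    ring
  rw [e1, e2, mul_pow, mul_pow]
  field_simp

theorem statement_11 (p q : ℕ) (w w' x y : ℂ) (hww' : w ≠ w') :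
    ∃ ε₀ > (0 : ℝ), ∀ ε : ℝ, 0 < ε → ε < ε₀ →
      (1 / (2 * (Real.pi : ℂ) * Complex.I)) *
          (∮ z in C(w, ε),
            (w - w') / ((z - w) ^ (p + 1) * (z - w') ^ (q + 1)) * (x - z * y) ^ (p + q)) =
        (-1) ^ p * ((p + q).choose p : ℂ) * (x - w' * y) ^ p * (x - w * y) ^ q /
          (w - w') ^ (p + q) := by
  have hD : w - w' ≠ 0 := sub_ne_zero.mpr hww'
  refine ⟨‖w - w'‖, norm_pos_iff.mpr hD, fun ε hε h => ?_⟩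
  rw [circleIntegral.integral_congr hε.le fun z hz =>
    div_mul_pow_eq_sum_zpow hD (ne_of_mem_sphere_of_lt hε h hz).1
      (ne_of_mem_sphere_of_lt hε h hz).2 p q x y]
  rw [circleIntegral.integral_fun_sum]
  swap
  · exact fun m _ => (circleIntegrable_zpow_mul_zpow hε h _ _).const_smul
  simp only [circleIntegral.integral_const_mul, circleIntegral_zpow_mul_zpow hε h]
  rw [Finset.sum_eq_single_of_mem p (Finset.mem_range.mpr (by omega)) fun m _ hm => by
    rw [if_neg (by omega), mul_zero]]
  rw [if_pos (sub_self _), Nat.add_sub_cancel_left, neg_pow]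
  have := Complex.two_pi_I_ne_zero
  have hpi : (Real.pi : ℂ) ≠ 0 := Complex.ofReal_ne_zero.mpr Real.pi_ne_zero
  field_simp
end
end

section
/- For every integer k ≥ 1 and all z, w in the upper half-plane ℍ with z ≠ w, the following identity holds: −Σ_{p=1}^{k} (1/p)·((conj z − z)·(conj w − w)/(z − w))^{p}·(conj z − conj w)^{k−p} + (conj z − conj w)^{k}·log(|z − w|²/|z − conj w|²) = ((conj z − z)·(conj w − w))^{k}·(z − w)^{−k}·𝓛_k(x(z,w)), where the logarithm is the real logarithm (coerced into ℂ). -/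
/- STATEMENT 12: The corner component of the generating function of the higher
Green's functions is given by the truncated logarithm:
`g^{k,0}_{k,0}(z,w) = (z−w)^{−k}·𝓛_k(x(z,w))` evaluated at the parameters
`(x,y,u,v) = (conj z, 1, conj w, 1)`. -/

open Complex ComplexConjugate

noncomputable section

/-- The truncated logarithm `𝓛_k(x) = −Σ_{p=1}^k x^{p−k}/p − x^{−k}·log(1−x)`,
the k-th Taylor remainder of `−log(1−x)`. -/
def Lrem (k : ℕ) (x : ℝ) : ℝ :=
  -(∑ p ∈ Finset.Icc 1 k, x ^ ((p : ℤ) - (k : ℤ)) / (p : ℝ)) -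
    x ^ (-(k : ℤ)) * Real.log (1 - x)

/-- `x(z,w) = −4·Im(z)·Im(w)/|z−w|²`. -/
def xCross (z w : ℂ) : ℝ :=
  (-(4 * z.im * w.im)) / Complex.normSq (z - w)

theorem conj_sub_mul_conj_sub_eq (z w : ℂ) (hzw : z ≠ w) :
    (conj z - z) * (conj w - w) = (xCross z w : ℂ) * ((z - w) * (conj z - conj w)) := by
  have hN : normSq (z - w) ≠ 0 := by simpa [sub_eq_zero] using hzw
  have hA : (conj z - z) * (conj w - w) = ((-(4 * z.im * w.im) : ℝ) : ℂ) := by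
    apply Complex.ext <;> simp
    ring
  rw [← map_sub, mul_conj, hA, ← ofReal_mul, xCross, div_mul_cancel₀ _ hN]

theorem one_sub_xCross (z w : ℂ) (hzw : z ≠ w) :
    1 - xCross z w = normSq (z - conj w) / normSq (z - w) := by
  have hN : normSq (z - w) ≠ 0 := by simpa [sub_eq_zero] using hzw
  rw [xCross, eq_div_iff hN, sub_mul, div_mul_cancel₀ _ hN]
  simp [normSq_apply]
  ring

theorem statement_12 (k : ℕ) (hk : 1 ≤ k) (z w : ℂ)
    (hz : 0 < z.im) (hw : 0 < w.im) (hzw : z ≠ w) :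
    -(∑ p ∈ Finset.Icc 1 k, (1 / (p : ℂ)) *
        (((conj z - z) * (conj w - w)) / (z - w)) ^ p * (conj z - conj w) ^ (k - p)) +
      (conj z - conj w) ^ k *
        ((Real.log (Complex.normSq (z - w) / Complex.normSq (z - conj w)) : ℝ) : ℂ) =
    ((conj z - z) * (conj w - w)) ^ k * (z - w) ^ (-(k : ℤ)) *
      ((Lrem k (xCross z w) : ℝ) : ℂ) := by
  have hD : z - w ≠ 0 := sub_ne_zero.mpr hzw
  have hE : conj z - conj w ≠ 0 := by
    rw [← map_sub]
    exact (map_ne_zero _).mpr hD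
  have hx : xCross z w ≠ 0 := by
    have : normSq (z - w) ≠ 0 := by simpa using hD
    exact div_ne_zero (neg_ne_zero.mpr (by positivity)) this
  have hlog : Real.log (normSq (z - w) / normSq (z - conj w)) =
      -Real.log (1 - xCross z w) := by
    rw [one_sub_xCross z w hzw, ← Real.log_inv, inv_div]
  rw [hlog, conj_sub_mul_conj_sub_eq z w hzw, Lrem]
  have hx' : (xCross z w : ℂ) ≠ 0 := ofReal_ne_zero.mpr hx
  generalize xCross z w = x at hx'
  generalize conj z - conj w = E at hE
  generalize z - w = D at hD
  push_cast
  rw [mul_sub, mul_neg, mul_neg, Finset.mul_sum, ← sub_eq_add_neg]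
  congr 1
  · congr 1
    refine Finset.sum_congr rfl fun p hp => ?_
    obtain ⟨m, rfl⟩ := Nat.exists_eq_add_of_le (Finset.mem_Icc.mp hp).2
    have hp0 : (p : ℂ) ≠ 0 := Nat.cast_ne_zero.mpr (by have := (Finset.mem_Icc.mp hp).1; omega)
    rw [zpow_sub₀ hx', Nat.add_sub_cancel_left]
    simp only [zpow_neg, zpow_natCast]
    have h : (x : ℂ) * (D * E) / D = x * E := by field_simp
    rw [h]
    simp only [mul_pow, pow_add]
    field_simp
  · simp only [zpow_neg, zpow_natCast, mul_pow]
    field_simp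
end
end
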